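/- Let n ≥ 1 and 0 ≤ s ≤ n, and let U ⊆ ℝⁿ be an open set containing 0 with the property that for every x = (x₁, …, xₙ) ∈ U, every index j with s < j ≤ n and every t ∈ [0,1], the point (x₁, …, x_{j−1}, t·x_j, 0, …, 0) also belongs to U (for example, U a product of open intervals each containing 0). If f : ℝⁿ → ℝ is real analytic on U and f(x) = 0 for every x ∈ U with x_{s+1} = ⋯ = xₙ = 0, then there exist functions g_{s+1}, …, gₙ, each real analytic on U, such that f(x) = Σ_{i=s+1}^{n} g_i(x)·x_i for all x ∈ U. -/

import Mathlib

open Set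

open Filter Topology in
/-- Difference of a multilinear map on two diagonals, telescoped. -/
lemma hadamard_telescope {E : Type*} [NormedAddCommGroup E] [NormedSpace ℝ E] (m : ℕ)
    (p : ContinuousMultilinearMap ℝ (fun _ : Fin (m + 1) => E) ℝ) (v w e : E) (c : ℝ)
    (h : v - w = c • e) :
    p (fun _ => v) - p (fun _ => w) =
      c * ∑ k : Fin (m + 1), p (k.insertNth e
        (fun i : Fin m => if k.succAbove i < k then v else w)) := by
  let a : ℕ → ℝ := fun k => p (fun i => if (i : ℕ) < k then v else w)
  have h1 : p (fun _ => v) - p (fun _ => w) = a (m + 1) - a 0 := by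
    have : ∀ i : Fin (m + 1), (i : ℕ) < m + 1 := fun i => i.2
    simp [a, this]
  rw [h1, ← Finset.sum_range_sub, ← Fin.sum_univ_eq_sum_range (fun k => a (k + 1) - a k),
    Finset.mul_sum]
  refine Finset.sum_congr rfl fun k _ => ?_
  let b : Fin (m + 1) → E := fun i => if i < k then v else w
  have e1 : (fun i : Fin (m + 1) => if (i : ℕ) < (k : ℕ) + 1 then v else w)
      = Function.update b k v := by
    funext i
    by_cases hi : i = k
    · subst hi; simp
    · have : (i : ℕ) ≠ k := fun h => hi (Fin.ext h)
      simp only [Function.update_of_ne hi, b, Fin.lt_def]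
      congr 1
      simp only [eq_iff_iff]; omega
  have e2 : (fun i : Fin (m + 1) => if (i : ℕ) < (k : ℕ) then v else w)
      = Function.update b k w := by
    funext i
    by_cases hi : i = k
    · subst hi; simp
    · simp only [Function.update_of_ne hi, b, Fin.lt_def]
  have e3 : (k.insertNth e (fun i : Fin m => if k.succAbove i < k then v else w) :
      Fin (m + 1) → E) = Function.update b k e := by
    funext i
    rcases Fin.eq_self_or_eq_succAbove k i with rfl | ⟨j, rfl⟩
    · simp
    · simp [b]
  simp only [a]
  rw [e1, e2, e3, ← p.map_update_sub, h, p.map_update_smul, smul_eq_mul]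

open Filter Topology in
/-- Local division by a linear form. -/
lemma hadamard_local {E : Type*} [NormedAddCommGroup E] [NormedSpace ℝ E]
    (F : E → ℝ) (l : E →L[ℝ] ℝ) (e x₀ : E) (hx₀ : l x₀ = 0) (hF : AnalyticAt ℝ F x₀) :
    ∃ Q : E → ℝ, AnalyticAt ℝ Q x₀ ∧
      ∀ᶠ y in 𝓝 x₀, F y - F (y - l y • e) = l y * Q y := by
  obtain ⟨p, hp⟩ := hF
  let π : E →L[ℝ] E := ContinuousLinearMap.id ℝ E - l.smulRight e
  have hπ : ∀ v, π v = v - l v • e := fun v => by simp [π]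
  let q : FormalMultilinearSeries ℝ E ℝ := fun m =>
    ∑ k : Fin (m + 1), ((p (m + 1)).curryMid k e).compContinuousLinearMap
      (fun i : Fin m => if k.succAbove i < k then ContinuousLinearMap.id ℝ E else π)
  have hq : ∀ (m : ℕ) (v : E), p (m + 1) (fun _ => v) - p (m + 1) (fun _ => π v)
      = l v * q m (fun _ => v) := by
    intro m v
    rw [hadamard_telescope m (p (m + 1)) v (π v) e (l v) (by rw [hπ]; abel)]
    congr 1
    simp only [q, sum_apply,
      ContinuousMultilinearMap.compContinuousLinearMap_apply,
      ContinuousMultilinearMap.curryMid_apply]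
    refine Finset.sum_congr rfl fun k _ => ?_
    congr 2
    funext i
    split_ifs <;> rfl
  -- radius
  have hrad : 0 < q.radius := by
    obtain ⟨r, hr0, hr⟩ := ENNReal.lt_iff_exists_nnreal_btwn.1 hp.radius_pos
    have hr0' : 0 < r := by exact_mod_cast hr0
    have hr0r : (0 : ℝ) < r := by exact_mod_cast hr0'
    obtain ⟨K, hK, hb⟩ := p.norm_le_div_pow_of_pos_of_lt_radius hr0' hr
    let C : NNReal := 1 + ‖π‖₊
    have hC0 : (0 : ℝ) < C := by simp only [C]; push_cast; positivity
    have hqm : ∀ m, ‖q m‖ ≤ (m + 1) * (K / (r : ℝ) ^ (m + 1) * ‖e‖ * (C : ℝ) ^ m) := by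
      intro m
      refine (norm_sum_le _ _).trans ?_
      refine (Finset.sum_le_card_nsmul _ _ (K / (r : ℝ) ^ (m + 1) * ‖e‖ * (C : ℝ) ^ m)
        fun k _ => ?_).trans_eq (by simp)
      refine (ContinuousMultilinearMap.norm_compContinuousLinearMap_le _ _).trans ?_
      have h1 : ‖(p (m + 1)).curryMid k e‖ ≤ K / (r : ℝ) ^ (m + 1) * ‖e‖ := by
        refine (ContinuousLinearMap.le_opNorm _ _).trans ?_
        rw [ContinuousMultilinearMap.norm_curryMid]
        gcongr
        exact hb _
      have h2 : ∏ i : Fin m, ‖(if k.succAbove i < k then ContinuousLinearMap.id ℝ E else π)‖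
          ≤ (C : ℝ) ^ m := by
        refine (Finset.prod_le_prod (g := fun _ => (C : ℝ))
          (fun _ _ => norm_nonneg _) ?_).trans_eq (by simp)
        intro i _
        split_ifs
        · refine ContinuousLinearMap.norm_id_le.trans ?_
          simp [C]
        · simp [C]
      exact mul_le_mul h1 h2 (Finset.prod_nonneg fun _ _ => norm_nonneg _) (by positivity)
    have hle : ((r / (2 * C) : NNReal) : ENNReal) ≤ q.radius := by
      refine q.le_radius_of_bound (K / r * ‖e‖) fun m => ?_
      have h2 : ((m : ℝ) + 1) ≤ 2 ^ m := by
        exact_mod_cast Nat.lt_two_pow_self (n := m)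
      calc ‖q m‖ * ((r / (2 * C) : NNReal) : ℝ) ^ m
          ≤ ((2 : ℝ) ^ m * (K / (r : ℝ) ^ (m + 1) * ‖e‖ * (C : ℝ) ^ m))
              * ((r / (2 * C) : NNReal) : ℝ) ^ m := by
            gcongr
            refine (hqm m).trans ?_
            gcongr
        _ = K / r * ‖e‖ := by
            push_cast
            rw [div_pow, mul_pow]
            field_simp
            ring
    refine lt_of_lt_of_le ?_ hle
    have : 0 < r / (2 * C) := by
      have : 0 < C := by exact_mod_cast hC0
      positivity
    exact_mod_cast this
  have hQ := q.hasFPowerSeriesOnBall hrad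
  have hsub : Tendsto (fun y => y - x₀) (𝓝 x₀) (𝓝 0) := by
    have : ContinuousAt (fun y => y - x₀) x₀ := by fun_prop
    simpa [ContinuousAt] using this
  have hπt : Tendsto (fun y => y - l y • e) (𝓝 x₀) (𝓝 x₀) := by
    have : ContinuousAt (fun y => y - l y • e) x₀ := by fun_prop
    simpa [ContinuousAt, hx₀] using this
  refine ⟨fun y => q.sum (y - x₀), ?_, ?_⟩
  · have h1 : AnalyticAt ℝ q.sum (x₀ - x₀) := by
      rw [sub_self]; exact hQ.analyticAt
    have h2 : AnalyticAt ℝ (fun y => y - x₀) x₀ := by fun_prop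
    exact AnalyticAt.comp (g := q.sum) (f := fun y => y - x₀) h1 h2
  · filter_upwards [hp.eventually_hasSum_sub, hπt.eventually hp.eventually_hasSum_sub,
      hsub.eventually hQ.eventually_hasSum] with y h1 h2 h3
    have hpy : y - l y • e - x₀ = π (y - x₀) := by
      rw [hπ, map_sub, hx₀, sub_zero]; abel
    rw [hpy] at h2
    have h4 := h1.sub h2
    rw [← hasSum_nat_add_iff' 1] at h4
    have hl : l (y - x₀) = l y := by rw [map_sub, hx₀, sub_zero]
    simp only [hq, hl] at h4
    have h5 := h3.mul_left (l y)
    have h6 := h4.unique h5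
    have h7 : (p 0 fun _ => y - x₀) = (p 0 fun _ => π (y - x₀)) := by
      congr 1; funext i; exact i.elim0
    simpa [h7] using h6

open Filter Topology in
/-- Global division by a linear form. -/
lemma hadamard_global {E : Type*} [NormedAddCommGroup E] [NormedSpace ℝ E]
    (F : E → ℝ) (l : E →L[ℝ] ℝ) (e : E) (he : l e = 1) (U : Set E)
    (hF : AnalyticOnNhd ℝ F U) (hF' : AnalyticOnNhd ℝ (fun y => F (y - l y • e)) U) :
    ∃ G : E → ℝ, AnalyticOnNhd ℝ G U ∧
      ∀ y, F y - F (y - l y • e) = G y * l y := by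
  classical
  refine ⟨fun y => if l y = 0 then deriv (fun t : ℝ => F (y + t • e)) 0
    else (F y - F (y - l y • e)) / l y, ?_, ?_⟩
  · intro x hx
    by_cases h : l x = 0
    · obtain ⟨Q, hQ, hQe⟩ := hadamard_local F l e x h (hF x hx)
      refine hQ.congr ?_
      filter_upwards [hQe.eventually_nhds, hQ.eventually_analyticAt] with y hy hQy
      by_cases hly : l y = 0
      · simp only [hly, if_true]
        have hc : ContinuousAt (fun t : ℝ => y + t • e) 0 := by fun_prop
        have ht : Tendsto (fun t : ℝ => y + t • e) (𝓝 0) (𝓝 y) := by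
          simpa [ContinuousAt] using hc
        have hev : (fun t : ℝ => F (y + t • e)) =ᶠ[𝓝 0]
            fun t => F y + t * Q (y + t • e) := by
          filter_upwards [ht.eventually hy] with t h1
          have : l (y + t • e) = t := by simp [hly, he]
          rw [this] at h1
          simp only [add_sub_cancel_right] at h1
          linarith
        rw [hev.deriv_eq]
        have hd : DifferentiableAt ℝ (fun t : ℝ => Q (y + t • e)) 0 := by
          have : DifferentiableAt ℝ Q (y + (0 : ℝ) • e) := by
            simpa using hQy.differentiableAt
          exact DifferentiableAt.comp (0 : ℝ) this (by fun_prop)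
        have := ((hasDerivAt_id (0 : ℝ)).mul hd.hasDerivAt).const_add (F y)
        have := this.deriv
        simpa using this.symm
      · have := hy.self_of_nhds
        simp only [hly, if_false]
        rw [this]; field_simp
    · have h1 : AnalyticAt ℝ (fun y => (F y - F (y - l y • e)) / l y) x :=
        ((hF x hx).sub (hF' x hx)).div (l.analyticAt x) h
      refine h1.congr ?_
      have : ∀ᶠ y in 𝓝 x, l y ≠ 0 := l.continuous.continuousAt.eventually_ne h
      filter_upwards [this] with y hy
      simp [hy]
  · intro y
    by_cases h : l y = 0
    · simp [h]
    · simp [h]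

/-- Hadamard-type lemma for analytic functions (Lemma 2.1 of the paper): if `f` is real
analytic on a suitable open neighbourhood `U` of `0` in `ℝⁿ` and vanishes on the slice
`{x ∈ U : x_{s+1} = ⋯ = xₙ = 0}` (`0`-indexed: `x_i = 0` for `s ≤ i`), then
`f(x) = Σ_{i ≥ s} g_i(x)·x_i` on `U` with each `g_i` analytic on `U`. -/
theorem hadamard_lemma_analytic (n s : ℕ) (hn : 1 ≤ n) (hs : s ≤ n)
    (U : Set (Fin n → ℝ)) (hU : IsOpen U) (h0 : (0 : Fin n → ℝ) ∈ U)
    (hUtrunc : ∀ x ∈ U, ∀ j : Fin n, s ≤ (j : ℕ) → ∀ t ∈ Icc (0 : ℝ) 1,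
      (fun i : Fin n =>
        if (i : ℕ) < (j : ℕ) then x i else if i = j then t * x i else 0) ∈ U)
    (f : (Fin n → ℝ) → ℝ) (hf : AnalyticOn ℝ f U)
    (hvanish : ∀ x ∈ U, (∀ i : Fin n, s ≤ (i : ℕ) → x i = 0) → f x = 0) :
    ∃ g : Fin n → ((Fin n → ℝ) → ℝ),
      (∀ i : Fin n, s ≤ (i : ℕ) → AnalyticOn ℝ (g i) U) ∧
      ∀ x ∈ U, f x = ∑ i ∈ Finset.univ.filter (fun i : Fin n => s ≤ (i : ℕ)),
        g i x * x i := by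
  have hfN : AnalyticOnNhd ℝ f U := hU.analyticOn_iff_analyticOnNhd.1 hf
  let P : ℕ → (Fin n → ℝ) →L[ℝ] (Fin n → ℝ) := fun k =>
    ContinuousLinearMap.pi fun i =>
      if (i : ℕ) < k then ContinuousLinearMap.proj i else 0
  have hP : ∀ k x i, P k x i = if (i : ℕ) < k then x i else 0 := by
    intro k x i
    simp only [P, ContinuousLinearMap.pi_apply]
    split_ifs <;> rfl
  have hPn : ∀ x, P n x = x := fun x => by
    funext i; simp [hP]
  have hPU : ∀ k, s ≤ k → k ≤ n → ∀ x ∈ U, P k x ∈ U := by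
    intro k hk hkn x hx
    rcases hkn.eq_or_lt with rfl | hlt
    · rwa [hPn]
    · convert hUtrunc x hx ⟨k, hlt⟩ hk 0 (by simp) using 1
      funext i
      simp [hP]
  have hPA : ∀ k, s ≤ k → k ≤ n → AnalyticOnNhd ℝ (fun x => f (P k x)) U := by
    intro k hk hkn x hx
    exact (hfN _ (hPU k hk hkn x hx)).fun_comp ((P k).analyticAt x)
  have key : ∀ j : Fin n, ∃ G : (Fin n → ℝ) → ℝ, s ≤ (j : ℕ) →
      AnalyticOnNhd ℝ G U ∧ ∀ y, f (P (j + 1) y) - f (P j y) = G y * y j := by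
    intro j
    by_cases hj : s ≤ (j : ℕ)
    · have hPj : ∀ y : Fin n → ℝ, P (j + 1)
          (y - (ContinuousLinearMap.proj (R := ℝ) (φ := fun _ : Fin n => ℝ) j) y •
            (Pi.single j 1 : Fin n → ℝ)) = P j y := by
        intro y
        funext i
        simp only [hP, Pi.sub_apply, Pi.smul_apply, ContinuousLinearMap.proj_apply, smul_eq_mul]
        by_cases hij : i = j
        · subst hij; simp
        · have : (i : ℕ) ≠ j := fun h => hij (Fin.ext h)
          have h2 : (i : ℕ) < j + 1 ↔ (i : ℕ) < j := by omega
          simp [hij, h2]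
      obtain ⟨G, hG, hG'⟩ := hadamard_global (fun x => f (P (j + 1) x))
        (ContinuousLinearMap.proj (R := ℝ) (φ := fun _ : Fin n => ℝ) j)
        (Pi.single j 1) (by simp) U (hPA _ (by omega) j.2)
        (by simp only [hPj]; exact hPA _ hj j.2.le)
      refine ⟨G, fun _ => ⟨hG, fun y => ?_⟩⟩
      have := hG' y
      simp only [hPj] at this
      exact this
    · exact ⟨0, fun h => absurd h hj⟩
  choose g hg using key
  refine ⟨g, fun i hi => (hg i hi).1.analyticOn, fun x hx => ?_⟩
  have hs0 : f (P s x) = 0 :=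
    hvanish _ (hPU s le_rfl hs x hx) fun i hi => by simp [hP, hi]
  have h1 : ∑ i ∈ Finset.univ.filter (fun i : Fin n => s ≤ (i : ℕ)), g i x * x i
      = ∑ i ∈ Finset.univ.filter (fun i : Fin n => s ≤ (i : ℕ)),
        (f (P (i + 1) x) - f (P i x)) := by
    refine Finset.sum_congr rfl fun i hi => ?_
    rw [(hg i (Finset.mem_filter.1 hi).2).2 x]
  rw [h1, Finset.sum_filter, Fin.sum_univ_eq_sum_range
    (fun k => if s ≤ k then f (P (k + 1) x) - f (P k x) else 0), ← Finset.sum_filter]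
  have h2 : (Finset.range n).filter (fun k => s ≤ k) = Finset.Ico s n := by
    ext k; simp [and_comm]
  rw [h2, Finset.sum_Ico_sub (fun k => f (P k x)) hs, hs0, hPn, sub_zero]
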